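/- There exist no u, X, Y ∈ K with v(u) > 0, X ≠ 0, Y ≠ 0, [π]_u(X) = [π]_u(Y) = 0, X^q Y − X Y^q = π₁, and both v(X) > 1/(q²−1) and v(Y) > 1/(q²−1). (In other words, for two π-torsion points forming a Drinfeld basis, the case v(X) = v(Y) = (1−v(u))/(q−1) cannot occur.) -/

import Mathlib

/-- for a Drinfeld basis (X,Y) of the π-torsion with Moore determinant π₁,
the case v(X) > 1/(q²−1) and v(Y) > 1/(q²−1) cannot occur. -/
theorem stmt_1 (p f q : ℕ) (hp : p.Prime) (hf : 0 < f) (hq : q = p ^ f)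
    (K : Type*) [Field K] [IsAlgClosed K] [CharP K p]
    (v : K → WithTop ℝ)
    (hv_top : ∀ x : K, v x = ⊤ ↔ x = 0)
    (hv_mul : ∀ x y : K, v (x * y) = v x + v y)
    (hv_add : ∀ x y : K, min (v x) (v y) ≤ v (x + y))
    (π : K) (hπ : v π = 1)
    (π₁ : K) (hπ₁ : π₁ ^ (q - 1) = π) :
    ¬ ∃ u X Y : K, 0 < v u ∧ X ≠ 0 ∧ Y ≠ 0 ∧
      X ^ q ^ 2 + u * X ^ q + π * X = 0 ∧
      Y ^ q ^ 2 + u * Y ^ q + π * Y = 0 ∧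
      X ^ q * Y - X * Y ^ q = π₁ ∧
      ((1 / ((q : ℝ) ^ 2 - 1) : ℝ) : WithTop ℝ) < v X ∧
      ((1 / ((q : ℝ) ^ 2 - 1) : ℝ) : WithTop ℝ) < v Y := by
  rintro ⟨u, X, Y, -, hX, hY, -, -, hdet, hvX, hvY⟩
  have hq2 : 2 ≤ q := hq ▸ hp.two_le.trans (Nat.le_self_pow hf.ne' p)
  have hv_one : v 1 = 0 := by
    have h := hv_mul 1 1
    rw [mul_one] at h
    obtain ⟨c, hc⟩ := WithTop.ne_top_iff_exists.1 (mt (hv_top 1).1 one_ne_zero)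
    rw [← hc] at h ⊢
    norm_cast at h ⊢
    linarith
  have hv_neg (x : K) : v (-x) = v x := by
    have h := hv_mul (-1) (-1)
    rw [neg_one_mul, neg_neg, hv_one] at h
    have h_neg_one : v (-1) = 0 := by
      obtain ⟨c, hc⟩ :=
        WithTop.ne_top_iff_exists.1 (mt (hv_top (-1)).1 (neg_ne_zero.2 one_ne_zero))
      rw [← hc] at h ⊢
      norm_cast at h ⊢
      linarith
    rw [← neg_one_mul, hv_mul, h_neg_one, zero_add]
  have hv_pow {x : K} {a : ℝ} (hx : v x = a) (n : ℕ) : v (x ^ n) = ((n * a : ℝ) : WithTop ℝ) := by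
    induction n with
    | zero => simp [hv_one]
    | succ n ih =>
      rw [pow_succ, hv_mul, ih, hx, ← WithTop.coe_add]
      congr 1
      push_cast
      ring
  obtain ⟨a, ha⟩ := WithTop.ne_top_iff_exists.1 (mt (hv_top X).1 hX)
  obtain ⟨b, hb⟩ := WithTop.ne_top_iff_exists.1 (mt (hv_top Y).1 hY)
  have hπ₁_ne : π₁ ≠ 0 := by
    rintro rfl
    rw [zero_pow (by omega)] at hπ₁
    rw [← hπ₁, (hv_top 0).2 rfl] at hπ
    exact WithTop.top_ne_one hπ
  obtain ⟨c, hc⟩ := WithTop.ne_top_iff_exists.1 (mt (hv_top π₁).1 hπ₁_ne)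
  have hc_eq : ((q : ℝ) - 1) * c = 1 := by
    have h := hv_pow hc.symm (q - 1)
    rw [hπ₁, hπ, Nat.cast_sub (by omega), Nat.cast_one] at h
    exact_mod_cast h.symm
  have hmin := hv_add (X ^ q * Y) (-(X * Y ^ q))
  rw [← sub_eq_add_neg, hdet, hv_neg, hv_mul, hv_mul, hv_pow ha.symm, hv_pow hb.symm,
    ← ha, ← hb, ← hc, ← WithTop.coe_add, ← WithTop.coe_add] at hmin
  rw [← ha, WithTop.coe_lt_coe] at hvX
  rw [← hb, WithTop.coe_lt_coe] at hvY
  have hqR : (2 : ℝ) ≤ q := by exact_mod_cast hq2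
  set r : ℝ := 1 / ((q : ℝ) ^ 2 - 1) with hr
  have hc_r : c = (q + 1) * r := by
    have h₁ : (q : ℝ) ^ 2 - 1 ≠ 0 := by nlinarith
    have h₂ : (q : ℝ) - 1 ≠ 0 := by linarith
    rw [hr, mul_one_div, eq_div_iff h₁]
    linear_combination ((q : ℝ) + 1) * hc_eq
  rcases min_le_iff.1 hmin with h | h <;> rw [WithTop.coe_le_coe] at h <;> nlinarith
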